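/- If η is a 2-form on ℝ⁷ in the 14-dimensional component Λ²₁₄ (i.e. ⋆(ψ₀ ∧ η) = −η), then |η ∧ η|² = |η|⁴, where the norms are the pointwise norms induced by the Euclidean metric on 4-forms and 2-forms respectively. In particular η ∧ η = 0 implies η = 0. -/

import Mathlib

/-!
Coefficient model of differential forms on ℝ⁷ with the Euclidean metric:
a `k`-form is represented by its (fully alternating) coefficient tensor
`(Fin k → Fin 7) → ℝ`.  We define the wedge product, Hodge star,
interior product, the standard volume form, and the G₂ three-form `φ₀`.

Note: the operator defining the decomposition Λ² = Λ²₇ ⊕ Λ²₁₄ is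
`β ↦ ⋆(φ₀ ∧ β)`, with eigenvalues `2` and `-1` (this is the operator
written `⋆(ψ ∧ β)` in some references; degree reasons force the 3-form).
-/

namespace G2R7

open scoped BigOperators Classical

noncomputable section

/-- A `k`-form on ℝ⁷, represented by its coefficient tensor. -/
abbrev Form (k : ℕ) : Type := (Fin k → Fin 7) → ℝ

/-- The coefficient tensor is fully alternating. -/
def IsAlt {k : ℕ} (α : Form k) : Prop :=
  (∀ i : Fin k → Fin 7, ¬ Function.Injective i → α i = 0) ∧
  (∀ (σ : Equiv.Perm (Fin k)) (i : Fin k → Fin 7),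
      α (i ∘ σ) = ((Equiv.Perm.sign σ : ℤ) : ℝ) * α i)

/-- Wedge product of forms (determinant convention). -/
def wedge {k l : ℕ} (α : Form k) (β : Form l) : Form (k + l) := fun i =>
  (1 / ((k.factorial : ℝ) * (l.factorial : ℝ))) *
    ∑ σ : Equiv.Perm (Fin (k + l)),
      ((Equiv.Perm.sign σ : ℤ) : ℝ)
        * α (fun a => i (σ (Fin.castAdd l a)))
        * β (fun b => i (σ (Fin.natAdd k b)))

/-- Levi-Civita symbol on 7 indices. -/
def eps (f : Fin 7 → Fin 7) : ℝ :=
  if h : Function.Bijective f then ((Equiv.Perm.sign (Equiv.ofBijective f h) : ℤ) : ℝ)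
  else 0

/-- Hodge star with respect to the Euclidean metric and standard orientation. -/
def hstar {k : ℕ} (α : Form k) : Form (7 - k) := fun j =>
  (1 / (k.factorial : ℝ)) *
    ∑ i : Fin k → Fin 7, α i *
      eps (fun t => if h : (t : ℕ) < k then i ⟨t, h⟩
        else if h' : (t : ℕ) - k < 7 - k then j ⟨(t : ℕ) - k, h'⟩ else t)

/-- Pointwise inner product of `k`-forms induced by the Euclidean metric
(coordinate wedge monomials are orthonormal). -/
def ipt {k : ℕ} (α β : Form k) : ℝ :=
  (1 / (k.factorial : ℝ)) * ∑ i : Fin k → Fin 7, α i * β i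

/-- Pointwise squared norm. -/
def normSq {k : ℕ} (α : Form k) : ℝ := ipt α α

/-- Standard volume form dx¹∧⋯∧dx⁷. -/
def vol : Form 7 := eps

/-- Coordinate 1-forms dxᵃ (0-indexed). -/
def dx (a : Fin 7) : Form 1 := fun i => if i 0 = a then 1 else 0

/-- dxᵃ ∧ dxᵇ ∧ dxᶜ. -/
def dx3 (a b c : Fin 7) : Form 3 := wedge (wedge (dx a) (dx b)) (dx c)

/-- The standard G₂ three-form
`φ₀ = dx¹²³ − dx¹⁶⁷ − dx⁵²⁷ − dx⁵⁶³ + dx⁴¹⁵ + dx⁴²⁶ + dx⁴³⁷` (0-indexed below). -/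
def φ₀ : Form 3 :=
  dx3 0 1 2 - dx3 0 5 6 - dx3 4 1 6 - dx3 4 5 2 + dx3 3 0 4 + dx3 3 1 5 + dx3 3 2 6

/-- The G₂ four-form ψ₀ = ⋆φ₀. -/
def ψ₀ : Form 4 := hstar φ₀

/-- Interior product X ⌟ α. -/
def iprod {k : ℕ} (X : Fin 7 → ℝ) (α : Form (k + 1)) : Form k := fun i =>
  ∑ a : Fin 7, X a * α (Fin.cons a i)

/-- Metric dual 1-form X♭ of a vector X. -/
def flat (X : Fin 7 → ℝ) : Form 1 := fun i => X (i 0)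

/-- The operator β ↦ ⋆(φ₀ ∧ β) on 2-forms whose eigenspaces give Λ²₇ and Λ²₁₄. -/
def Lop (β : Form 2) : Form 2 := hstar (wedge φ₀ β)

/-- β lies in the 7-dimensional component Λ²₇ (eigenvalue 2). -/
def in7 (β : Form 2) : Prop := Lop β = (2 : ℝ) • β

/-- β lies in the 14-dimensional component Λ²₁₄ (eigenvalue −1). -/
def in14 (β : Form 2) : Prop := Lop β = -β

end
end G2R7


namespace G2R7

open Equiv

lemma eps_comp_perm (τ : Perm (Fin 7)) (f : Fin 7 → Fin 7) :
    eps (f ∘ τ) = ((Perm.sign τ : ℤ) : ℝ) * eps f := by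
  unfold eps
  by_cases hf : Function.Bijective f
  · have h : Function.Bijective (f ∘ τ) := hf.comp τ.bijective
    have heq : Equiv.ofBijective (f ∘ τ) h = Equiv.ofBijective f hf * τ := by
      ext x; rfl
    rw [dif_pos h, dif_pos hf, heq, Perm.sign_mul]
    push_cast
    ring
  · have h : ¬ Function.Bijective (f ∘ τ) := by
      rwa [τ.bijective.of_comp_iff]
    rw [dif_neg h, dif_neg hf, mul_zero]

lemma eps_eq_sign_mul_of_embedding {k : ℕ} (e : Fin k ↪ Fin 7) (σ : Perm (Fin k))
    {v w : Fin 7 → Fin 7} (h : ∀ a, w (e a) = v (e (σ a)))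
    (h' : ∀ t, t ∉ Set.range e → w t = v t) :
    eps w = ((Perm.sign σ : ℤ) : ℝ) * eps v := by
  rw [← Perm.viaFintypeEmbedding_sign σ e, ← eps_comp_perm]
  congr 1
  funext t
  by_cases ht : t ∈ Set.range e
  · obtain ⟨a, rfl⟩ := ht
    simp [h]
  · simp [h' t ht, Perm.viaFintypeEmbedding_apply_notMem_range _ _ ht]

/-- The sign of the permutation sorting a list, or `0` if the list has a repetition. -/
def sortSign {n : ℕ} : List (Fin n) → ℤ
  | [] => 1
  | a :: l => l.foldr (fun b x => if a < b then x else if a = b then 0 else -x) (sortSign l)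

lemma sortSign_ofFn {n m : ℕ} (f : Fin m → Fin n) :
    sortSign (List.ofFn f) =
      ∏ i, ∏ j ∈ Finset.Ioi i, if f i < f j then 1 else if f i = f j then 0 else -1 := by
  have hfold (a : Fin n) (l : List (Fin n)) (x : ℤ) :
      l.foldr (fun b x => if a < b then x else if a = b then 0 else -x) x =
        (l.map fun b => if a < b then (1 : ℤ) else if a = b then 0 else -1).prod * x := by
    induction l with
    | nil => simp
    | cons b l ih =>
      simp only [List.foldr_cons, ih, List.map_cons, List.prod_cons]
      split_ifs <;> ring
  induction m with
  | zero => simp [sortSign]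
  | succ m ih =>
    rw [List.ofFn_succ, sortSign, hfold, ih, Fin.prod_univ_succ, List.map_ofFn, List.prod_ofFn]
    congr 1
    · simp only [Fin.Ioi_zero_eq_map, Finset.prod_map]
      rfl
    · refine Finset.prod_congr rfl fun i _ => ?_
      rw [← Fin.map_succEmb_Ioi, Finset.prod_map]
      rfl

lemma sign_eq_sortSign {n : ℕ} (σ : Perm (Fin n)) :
    (Perm.sign σ : ℤ) = sortSign (List.ofFn σ) := by
  rw [sortSign_ofFn, Perm.sign_eq_prod_prod_Ioi]
  push_cast
  refine Finset.prod_congr rfl fun i _ => Finset.prod_congr rfl fun j hj => ?_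
  have hij : σ i ≠ σ j := fun h => (Finset.mem_Ioi.1 hj).ne (σ.injective h)
  simp only [hij, if_false]
  split_ifs <;> rfl

/-- An integer-valued, computable form of the Levi-Civita symbol. -/
def epsInt (f : Fin 7 → Fin 7) : ℤ := sortSign (List.ofFn f)

lemma eps_eq_epsInt (f : Fin 7 → Fin 7) : eps f = (epsInt f : ℝ) := by
  unfold eps epsInt
  split_ifs with hf
  · rw [sign_eq_sortSign]
    rfl
  · have hinj : ¬ Function.Injective f := fun h => hf (Finite.injective_iff_bijective.1 h)
    obtain ⟨i, j, hij, hne⟩ : ∃ i j, f i = f j ∧ i < j := by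
      simp only [Function.Injective, not_forall] at hinj
      obtain ⟨i, j, h, hne⟩ := hinj
      rcases lt_or_gt_of_ne hne with h1 | h1
      exacts [⟨i, j, h, h1⟩, ⟨j, i, h.symm, h1⟩]
    symm
    rw [Int.cast_eq_zero, sortSign_ofFn]
    refine Finset.prod_eq_zero (Finset.mem_univ i) (Finset.prod_eq_zero (i := j) (by simpa) ?_)
    simp [hij]

lemma sum_wedge_mul {k l : ℕ} (α : Form k) (β : Form l) (F : Form (k + l))
    (hF : ∀ (σ : Perm (Fin (k + l))) i, F (i ∘ σ) = ((Perm.sign σ : ℤ) : ℝ) * F i) :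
    ∑ i, wedge α β i * F i = ((k + l).factorial / (k.factorial * l.factorial) : ℝ) *
      ∑ i : Fin (k + l) → Fin 7,
        α (fun a => i (Fin.castAdd l a)) * β (fun b => i (Fin.natAdd k b)) * F i := by
  have key (σ : Perm (Fin (k + l))) :
      ∑ i : Fin (k + l) → Fin 7, ((Perm.sign σ : ℤ) : ℝ)
        * α (fun a => i (σ (Fin.castAdd l a))) * β (fun b => i (σ (Fin.natAdd k b))) * F i =
      ∑ i : Fin (k + l) → Fin 7,
        α (fun a => i (Fin.castAdd l a)) * β (fun b => i (Fin.natAdd k b)) * F i := by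
    refine Fintype.sum_equiv (Equiv.arrowCongr σ.symm (Equiv.refl _)) _ _ fun i => ?_
    have h := hF σ i
    simp only [Equiv.arrowCongr, Equiv.coe_fn_mk, Equiv.symm_symm, Equiv.coe_refl,
      Function.id_comp, Function.comp_apply, h]
    ring
  simp only [wedge, mul_assoc (1 / _ : ℝ), ← Finset.mul_sum, Finset.sum_mul]
  rw [Finset.sum_comm]
  simp only [key, Finset.sum_const, Finset.card_univ, Fintype.card_perm, Fintype.card_fin,
    nsmul_eq_mul]
  ring

lemma sum_cons {M : Type*} [AddCommMonoid M] {n : ℕ} (F : (Fin (n + 1) → Fin 7) → M) :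
    ∑ i, F i = ∑ a, ∑ i : Fin n → Fin 7, F (Matrix.vecCons a i) := by
  rw [← Fintype.sum_prod_type']
  exact (Fintype.sum_equiv (Fin.consEquiv fun _ => Fin 7) _ _ fun _ => rfl).symm

lemma sum_fin_zero {M : Type*} [AddCommMonoid M] (F : (Fin 0 → Fin 7) → M) :
    ∑ i, F i = F ![] := by
  rw [Finset.univ_unique, Finset.sum_singleton]
  exact congrArg F (Subsingleton.elim _ _)

lemma dx_apply (a : Fin 7) (i : Fin 1 → Fin 7) : dx a i = if i 0 = a then 1 else 0 := by
  unfold dx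
  congr

lemma sum_dx3_mul (a b c : Fin 7) (F : Form 3)
    (hF : ∀ (σ : Perm (Fin 3)) i, F (i ∘ σ) = ((Perm.sign σ : ℤ) : ℝ) * F i) :
    ∑ i, dx3 a b c i * F i = 6 * F ![a, b, c] := by
  have hswap : F ![b, a, c] = - F ![a, b, c] := by
    have h := hF (swap 0 1) ![a, b, c]
    rw [Perm.sign_swap (by decide)] at h
    have h' : ![a, b, c] ∘ swap (0 : Fin 3) 1 = ![b, a, c] := by
      funext t; fin_cases t <;> rfl
    rw [h'] at h
    simpa using h
  have h2 (i : Fin 2 → Fin 7) : wedge (dx a) (dx b) i =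
      (if i 0 = a then 1 else 0) * (if i 1 = b then 1 else 0)
        - (if i 1 = a then 1 else 0) * (if i 0 = b then 1 else 0) := by
    have hu : (Finset.univ : Finset (Perm (Fin (1 + 1)))) = {1, swap 0 1} := by decide
    rw [wedge, hu, Finset.sum_pair (by decide), Perm.sign_swap (by decide)]
    simp [dx_apply, sub_eq_add_neg, -mul_ite, -ite_mul]
  refine (sum_wedge_mul (wedge (dx a) (dx b)) (dx c) F hF).trans ?_
  simp only [h2, sum_cons, sum_fin_zero]
  have hterm (x y z : Fin 7) :
      ((if x = a then 1 else 0) * (if y = b then 1 else 0)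
        - (if y = a then 1 else 0) * (if x = b then 1 else 0)) * (if z = c then 1 else 0)
          * F ![x, y, z] =
      (if z = c then if y = b then if x = a then F ![x, y, z] else 0 else 0 else 0)
        - if z = c then if y = a then if x = b then F ![x, y, z] else 0 else 0 else 0 := by
    split_ifs <;> simp
  refine (congrArg _ (Finset.sum_congr rfl fun x _ => Finset.sum_congr rfl fun y _ =>
    Finset.sum_congr rfl fun z _ => ?_)).trans
      (b := _ * ∑ x, ∑ y, ∑ z, ((if z = c then if y = b then if x = a then F ![x, y, z]
        else 0 else 0 else 0) - if z = c then if y = a then if x = b then F ![x, y, z]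
        else 0 else 0 else 0)) ?_
  · rw [← hterm, dx_apply]
    rfl
  · simp only [Finset.sum_sub_distrib, Finset.sum_ite_eq', Finset.mem_univ, if_true, hswap]
    norm_num [Nat.factorial]
    ring

lemma hstar_wedge_apply {k l : ℕ} (hkl : k + l ≤ 7) (α : Form k) (β : Form l)
    (j : Fin (7 - (k + l)) → Fin 7) :
    hstar (wedge α β) j = (1 / (k.factorial * l.factorial) : ℝ) *
      ∑ i : Fin (k + l) → Fin 7,
        α (fun a => i (Fin.castAdd l a)) * β (fun b => i (Fin.natAdd k b)) *
      eps (fun t => if h : (t : ℕ) < k + l then i ⟨t, h⟩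
        else if h' : (t : ℕ) - (k + l) < 7 - (k + l) then j ⟨(t : ℕ) - (k + l), h'⟩ else t) := by
  rw [hstar, sum_wedge_mul]
  · have := Nat.factorial_ne_zero (k + l)
    rw [← mul_assoc]
    congr 1
    field_simp
  · intro σ i
    refine eps_eq_sign_mul_of_embedding (Fin.castLEEmb hkl) σ (fun a => ?_) fun t ht => ?_
    · simp
    · have : ¬ (t : ℕ) < k + l := fun h => ht ⟨⟨t, h⟩, rfl⟩
      simp [this]

/-- The components of `⋆φ₀`. -/
def psiInt (p q r s : Fin 7) : ℤ :=
  epsInt ![0, 1, 2, p, q, r, s] - epsInt ![0, 5, 6, p, q, r, s]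
    - epsInt ![4, 1, 6, p, q, r, s] - epsInt ![4, 5, 2, p, q, r, s]
    + epsInt ![3, 0, 4, p, q, r, s] + epsInt ![3, 1, 5, p, q, r, s]
    + epsInt ![3, 2, 6, p, q, r, s]

lemma sum_φ₀_mul (F : Form 3)
    (hF : ∀ (σ : Perm (Fin 3)) i, F (i ∘ σ) = ((Perm.sign σ : ℤ) : ℝ) * F i) :
    ∑ i, φ₀ i * F i = 6 * (F ![0, 1, 2] - F ![0, 5, 6] - F ![4, 1, 6] - F ![4, 5, 2]
      + F ![3, 0, 4] + F ![3, 1, 5] + F ![3, 2, 6]) := by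
  simp only [φ₀, Pi.add_apply, Pi.sub_apply, add_mul, sub_mul, Finset.sum_add_distrib,
    Finset.sum_sub_distrib, sum_dx3_mul _ _ _ F hF]
  ring

lemma Lop_apply (η : Form 2) (r s : Fin 7) :
    Lop η ![r, s] = (1 / 2) * ∑ p, ∑ q, η ![p, q] * (psiInt p q r s : ℝ) := by
  have h (p q : Fin 7) : ∑ i : Fin 3 → Fin 7, φ₀ i * eps ![i 0, i 1, i 2, p, q, r, s] =
      6 * (psiInt p q r s : ℝ) := by
    rw [sum_φ₀_mul fun i => eps ![i 0, i 1, i 2, p, q, r, s]]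
    · simp [psiInt, eps_eq_epsInt]
    · intro σ i
      refine eps_eq_sign_mul_of_embedding (Fin.castLEEmb (by norm_num)) σ (fun a => ?_)
        fun t ht => ?_
      · have (b : Fin 3) : ![i 0, i 1, i 2, p, q, r, s] (Fin.castLE (by norm_num) b) = i b := by
          fin_cases b <;> rfl
        have h' : ![(i ∘ σ) 0, (i ∘ σ) 1, (i ∘ σ) 2, p, q, r, s]
            (Fin.castLE (by norm_num) a) = i (σ a) := by
          fin_cases a <;> rfl
        exact h'.trans (this _).symm
      · have : ¬ (t : ℕ) < 3 := fun h => ht ⟨⟨t, h⟩, rfl⟩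
        fin_cases t <;> simp at this <;> rfl
  have e (i : Fin (3 + 2) → Fin 7) : eps (fun t => if h : (t : ℕ) < 3 + 2 then i ⟨t, h⟩
        else if h' : (t : ℕ) - (3 + 2) < 7 - (3 + 2) then
          (![r, s] : Fin 2 → Fin 7) ⟨(t : ℕ) - (3 + 2), h'⟩ else t) =
      eps ![i 0, i 1, i 2, i 3, i 4, r, s] := by
    congr 1
    funext t
    fin_cases t <;> rfl
  rw [Lop]
  refine (hstar_wedge_apply (by norm_num) φ₀ η ![r, s]).trans ?_
  simp only [e]
  rw [← Equiv.sum_comp (Fin.appendEquiv 3 2), Fintype.sum_prod_type, Finset.sum_comm]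
  simp only [sum_cons (n := 1), sum_cons (n := 0), sum_fin_zero]
  have e' (p q : Fin 7) (v : Fin 3 → Fin 7) :
      ((φ₀ fun a => (Fin.appendEquiv 3 2) (v, ![p, q]) (Fin.castAdd 2 a)) *
        η fun b => (Fin.appendEquiv 3 2) (v, ![p, q]) (Fin.natAdd 3 b)) *
      eps ![(Fin.appendEquiv 3 2) (v, ![p, q]) 0, (Fin.appendEquiv 3 2) (v, ![p, q]) 1,
        (Fin.appendEquiv 3 2) (v, ![p, q]) 2, (Fin.appendEquiv 3 2) (v, ![p, q]) 3,
        (Fin.appendEquiv 3 2) (v, ![p, q]) 4, r, s] =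
      η ![p, q] * (φ₀ v * eps ![v 0, v 1, v 2, p, q, r, s]) := by
    have h1 : (fun a => (Fin.appendEquiv 3 2) (v, ![p, q]) (Fin.castAdd 2 a)) = v := by
      funext a; exact Fin.append_left _ _ _
    have h2 : (fun b => (Fin.appendEquiv 3 2) (v, ![p, q]) (Fin.natAdd 3 b)) = ![p, q] := by
      funext a; exact Fin.append_right _ _ _
    rw [h1, h2, mul_comm (φ₀ v), mul_assoc]
    rfl
  refine (congrArg _ (Finset.sum_congr rfl fun p _ => Finset.sum_congr rfl fun q _ =>
    Finset.sum_congr rfl fun v _ => e' p q v)).trans ?_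
  simp only [← Finset.mul_sum, h]
  simp only [mul_left_comm _ (6 : ℝ), ← Finset.mul_sum]
  norm_num [Nat.factorial, ← mul_assoc]

lemma IsAlt.swap_apply {η : Form 2} (h : IsAlt η) (a b : Fin 7) : η ![b, a] = -η ![a, b] := by
  have h2 := h.2 (swap 0 1) ![a, b]
  rw [Perm.sign_swap (by decide)] at h2
  have h' : ![a, b] ∘ swap (0 : Fin 2) 1 = ![b, a] := by
    funext t; fin_cases t <;> rfl
  rw [h'] at h2
  simpa using h2

lemma wedge_self_apply {η : Form 2} (h : IsAlt η) (a b c d : Fin 7) :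
    wedge η η ![a, b, c, d] = 2 * (η ![a, b] * η ![c, d] - η ![a, c] * η ![b, d]
      + η ![a, d] * η ![b, c]) := by
  have hperm : (Finset.univ : Finset (Perm (Fin 4))).val.map
      (fun σ : Perm (Fin 4) => (σ 0, σ 1, σ 2, σ 3)) =
      {(0, 1, 2, 3), (0, 1, 3, 2), (0, 2, 1, 3), (0, 2, 3, 1), (0, 3, 2, 1), (0, 3, 1, 2),
        (1, 0, 2, 3), (1, 0, 3, 2), (1, 2, 0, 3), (1, 2, 3, 0), (1, 3, 2, 0), (1, 3, 0, 2),
        (2, 1, 0, 3), (2, 1, 3, 0), (2, 0, 1, 3), (2, 0, 3, 1), (2, 3, 0, 1), (2, 3, 1, 0),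
        (3, 1, 2, 0), (3, 1, 0, 2), (3, 2, 1, 0), (3, 2, 0, 1), (3, 0, 2, 1), (3, 0, 1, 2)} := by
    decide +kernel
  let v : Fin 4 → Fin 7 := ![a, b, c, d]
  let g : Fin 4 × Fin 4 × Fin 4 × Fin 4 → ℝ := fun t =>
    (sortSign [t.1, t.2.1, t.2.2.1, t.2.2.2] : ℝ) * η ![v t.1, v t.2.1]
      * η ![v t.2.2.1, v t.2.2.2]
  have e (σ : Perm (Fin 4)) : ((Perm.sign σ : ℤ) : ℝ)
        * η (fun i => v (σ (Fin.castAdd 2 i))) * η (fun i => v (σ (Fin.natAdd 2 i))) =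
      g (σ 0, σ 1, σ 2, σ 3) := by
    rw [sign_eq_sortSign]
    congr 2
    · congr 1; funext i; fin_cases i <;> rfl
    · funext i; fin_cases i <;> rfl
  have hsum : ∑ σ : Perm (Fin 4), g (σ 0, σ 1, σ 2, σ 3) =
      8 * (η ![a, b] * η ![c, d] - η ![a, c] * η ![b, d] + η ![a, d] * η ![b, c]) := by
    have hmap := congrArg (fun s => (s.map g).sum) hperm
    simp only [Multiset.map_map] at hmap
    refine hmap.trans ?_
    simp only [Multiset.insert_eq_cons, Multiset.map_cons, Multiset.sum_cons,
      Multiset.map_singleton, Multiset.sum_singleton, g]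
    have v0 : v 0 = a := rfl
    have v1 : v 1 = b := rfl
    have v2 : v 2 = c := rfl
    have v3 : v 3 = d := rfl
    simp only [v0, v1, v2, v3, h.swap_apply a b, h.swap_apply a c, h.swap_apply a d,
      h.swap_apply b c, h.swap_apply b d, h.swap_apply c d]
    simp [sortSign]
    ring
  refine (congrArg _ ((Finset.sum_congr rfl fun σ _ => e σ).trans hsum)).trans ?_
  norm_num [Nat.factorial]
  ring

lemma sum_quadratic_sq {ι : Type*} [Fintype ι] (x : ι → ι → ℝ) (hx : ∀ a b, x b a = -x a b) :
    ∑ a, ∑ b, ∑ c, ∑ d, (x a b * x c d - x a c * x b d + x a d * x b c) ^ 2 =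
      3 * (∑ a, ∑ b, x a b ^ 2) ^ 2 - 6 * ∑ a, ∑ b, (∑ c, x a c * x c b) ^ 2 := by
  have hA : ∑ a, ∑ b, ∑ c, ∑ d, x a b ^ 2 * x c d ^ 2 = (∑ a, ∑ b, x a b ^ 2) ^ 2 := by
    simp only [← Finset.mul_sum, ← Finset.sum_mul, sq (∑ a, ∑ b, x a b ^ 2)]
  have hB : ∑ a, ∑ b, ∑ c, ∑ d, x a c ^ 2 * x b d ^ 2 = (∑ a, ∑ b, x a b ^ 2) ^ 2 := by
    rw [← hA]
    exact Finset.sum_congr rfl fun a _ => Finset.sum_comm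
  have hC : ∑ a, ∑ b, ∑ c, ∑ d, x a d ^ 2 * x b c ^ 2 = (∑ a, ∑ b, x a b ^ 2) ^ 2 := by
    simp only [← Finset.mul_sum, ← Finset.sum_mul, sq (∑ a, ∑ b, x a b ^ 2)]
  have hBC : ∑ a, ∑ b, ∑ c, ∑ d, x a c * x b d * (x a d * x b c) =
      ∑ a, ∑ b, (∑ c, x a c * x c b) ^ 2 := by
    refine Finset.sum_congr rfl fun a _ => Finset.sum_congr rfl fun b _ => ?_
    rw [sq, Finset.sum_mul_sum]
    refine Finset.sum_congr rfl fun c _ => Finset.sum_congr rfl fun d _ => ?_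
    rw [hx b c, hx b d]
    ring
  have hAC : ∑ a, ∑ b, ∑ c, ∑ d, x a b * x c d * (x a d * x b c) =
      -∑ a, ∑ b, (∑ c, x a c * x c b) ^ 2 := by
    simp only [← Finset.sum_neg_distrib]
    refine Finset.sum_congr rfl fun a _ => Finset.sum_comm.trans ?_
    refine Finset.sum_congr rfl fun c _ => ?_
    rw [sq, Finset.sum_mul_sum]
    simp only [← Finset.sum_neg_distrib]
    refine Finset.sum_congr rfl fun b _ => Finset.sum_congr rfl fun d _ => ?_
    rw [hx d c]
    ring
  have hAB : ∑ a, ∑ b, ∑ c, ∑ d, x a b * x c d * (x a c * x b d) =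
      ∑ a, ∑ b, (∑ c, x a c * x c b) ^ 2 := by
    refine Finset.sum_congr rfl fun a _ => ?_
    calc ∑ b, ∑ c, ∑ d, x a b * x c d * (x a c * x b d)
        = ∑ b, ∑ d, ∑ c, x a b * x c d * (x a c * x b d) :=
          Finset.sum_congr rfl fun b _ => Finset.sum_comm
      _ = ∑ d, ∑ b, ∑ c, x a b * x c d * (x a c * x b d) := Finset.sum_comm
      _ = _ := by
        refine Finset.sum_congr rfl fun d _ => ?_
        rw [sq, Finset.sum_mul_sum]
        refine Finset.sum_congr rfl fun b _ => Finset.sum_congr rfl fun c _ => ?_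
        ring
  have hexp (a b c d : ι) : (x a b * x c d - x a c * x b d + x a d * x b c) ^ 2 =
      x a b ^ 2 * x c d ^ 2 + x a c ^ 2 * x b d ^ 2 + x a d ^ 2 * x b c ^ 2
        - 2 * (x a b * x c d * (x a c * x b d)) + 2 * (x a b * x c d * (x a d * x b c))
        - 2 * (x a c * x b d * (x a d * x b c)) := by ring
  simp only [hexp, Finset.sum_add_distrib, Finset.sum_sub_distrib, ← Finset.mul_sum (a := (2 : ℝ))]
  rw [hA, hB, hC, hAB, hAC, hBC]
  ring

/-- The seven linear equations cutting out `Λ²₁₄` in `Λ²`. -/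
lemma in14.components {η : Form 2} (halt : IsAlt η) (h : in14 η) :
    η ![1, 2] = η ![3, 4] + η ![5, 6] ∧ η ![0, 2] = η ![4, 6] - η ![3, 5] ∧
    η ![0, 1] = η ![3, 6] + η ![4, 5] ∧ η ![0, 4] = -η ![1, 5] - η ![2, 6] ∧
    η ![0, 3] = η ![2, 5] - η ![1, 6] ∧ η ![0, 6] = η ![1, 3] + η ![2, 4] ∧
    η ![0, 5] = η ![1, 4] - η ![2, 3] := by
  have key (r s p₁ q₁ p₂ q₂ : Fin 7) (m n : ℤ)
      (hψ : ∀ p q, psiInt p q r s = (if p = p₁ ∧ q = q₁ then m else 0)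
        - (if p = q₁ ∧ q = p₁ then m else 0) + (if p = p₂ ∧ q = q₂ then n else 0)
        - (if p = q₂ ∧ q = p₂ then n else 0)) :
      η ![r, s] = -(m * η ![p₁, q₁] + n * η ![p₂, q₂]) := by
    have h1 := Lop_apply η r s
    rw [h] at h1
    simp only [hψ, ite_and, Int.cast_add, Int.cast_sub, Int.cast_ite, Int.cast_zero, mul_add,
      mul_sub, Finset.sum_add_distrib, Finset.sum_sub_distrib, mul_ite, mul_zero,
      Finset.sum_ite_eq', Finset.sum_ite_irrel, Finset.sum_const_zero, Finset.mem_univ, if_true,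
      Pi.neg_apply, halt.swap_apply p₁ q₁, halt.swap_apply p₂ q₂] at h1
    linear_combination -h1
  have e₂ := key 0 2 3 5 4 6 1 (-1) (by decide +kernel)
  have e₃ := key 0 1 3 6 4 5 (-1) (-1) (by decide +kernel)
  have e₄ := key 0 4 1 5 2 6 1 1 (by decide +kernel)
  have e₅ := key 0 3 1 6 2 5 1 (-1) (by decide +kernel)
  have e₆ := key 0 6 1 3 2 4 (-1) (-1) (by decide +kernel)
  have e₇ := key 0 5 1 4 2 3 (-1) 1 (by decide +kernel)
  have e₁ := key 1 2 3 4 5 6 (-1) (-1) (by decide +kernel)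
  push_cast at *
  refine ⟨?_, ?_, ?_, ?_, ?_, ?_, ?_⟩ <;> linarith

lemma in14.four_mul_trace_pow_four {η : Form 2} (halt : IsAlt η) (h : in14 η) :
    4 * ∑ a, ∑ b, (∑ c, η ![a, c] * η ![c, b]) ^ 2 = (∑ a, ∑ b, η ![a, b] ^ 2) ^ 2 := by
  obtain ⟨e₁, e₂, e₃, e₄, e₅, e₆, e₇⟩ := in14.components halt h
  have hs := halt.swap_apply
  have hd (a : Fin 7) : η ![a, a] = 0 := by linarith [hs a a]
  simp only [Fin.sum_univ_seven, hd, hs 0 1, hs 0 2, hs 0 3, hs 0 4, hs 0 5, hs 0 6, hs 1 2, hs 1 3,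
    hs 1 4, hs 1 5, hs 1 6, hs 2 3, hs 2 4, hs 2 5, hs 2 6, hs 3 4, hs 3 5, hs 3 6, hs 4 5, hs 4 6,
    hs 5 6, e₁, e₂, e₃, e₄, e₅, e₆, e₇]
  ring

lemma normSq_eq_sum (η : Form 2) : normSq η = (1 / 2) * ∑ a, ∑ b, η ![a, b] ^ 2 := by
  rw [normSq, ipt]
  simp only [sum_cons, sum_fin_zero, ← sq]
  rfl

lemma normSq_wedge_self {η : Form 2} (h : IsAlt η) :
    normSq (wedge η η) = (1 / 2) * (∑ a, ∑ b, η ![a, b] ^ 2) ^ 2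
      - ∑ a, ∑ b, (∑ c, η ![a, c] * η ![c, b]) ^ 2 := by
  have e : ∑ i : Fin 4 → Fin 7, wedge η η i * wedge η η i =
      4 * ∑ a, ∑ b, ∑ c, ∑ d, (η ![a, b] * η ![c, d] - η ![a, c] * η ![b, d]
        + η ![a, d] * η ![b, c]) ^ 2 := by
    simp only [sum_cons, sum_fin_zero, Finset.mul_sum]
    refine Finset.sum_congr rfl fun a _ => Finset.sum_congr rfl fun b _ =>
      Finset.sum_congr rfl fun c _ => Finset.sum_congr rfl fun d _ => ?_
    have h' := wedge_self_apply h a b c d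
    linear_combination (wedge η η ![a, b, c, d] + 2 * (η ![a, b] * η ![c, d]
      - η ![a, c] * η ![b, d] + η ![a, d] * η ![b, c])) * h'
  refine (congrArg (1 / ((Nat.factorial 4 : ℕ) : ℝ) * ·) e).trans ?_
  rw [sum_quadratic_sq (fun a b => η ![a, b]) h.swap_apply]
  norm_num [Nat.factorial]
  ring

lemma eq_zero_of_normSq_eq_zero {k : ℕ} {α : Form k} (h : normSq α = 0) : α = 0 := by
  have hk : (1 / (k.factorial : ℝ)) ≠ 0 := by positivity
  rw [normSq, ipt, mul_eq_zero, or_iff_right hk,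
    Finset.sum_eq_zero_iff_of_nonneg fun i _ => mul_self_nonneg _] at h
  funext i
  exact mul_self_eq_zero.1 (h i (Finset.mem_univ i))

end G2R7

open G2R7

/-- for η ∈ Λ²₁₄, |η ∧ η|² = |η|⁴; in particular η∧η = 0 implies η = 0. -/
theorem stmt6 (η : Form 2) (halt : IsAlt η) (h14 : in14 η) :
    normSq (wedge η η) = (normSq η) ^ 2 ∧ (wedge η η = 0 → η = 0) := by
  have h : normSq (wedge η η) = (normSq η) ^ 2 := by
    rw [normSq_wedge_self halt, normSq_eq_sum]
    linear_combination (-1 / 4) * in14.four_mul_trace_pow_four halt h14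
  refine ⟨h, fun h0 => eq_zero_of_normSq_eq_zero (pow_eq_zero_iff two_ne_zero |>.1 ?_)⟩
  rw [← h, h0]
  simp [normSq, ipt]
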